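/- arXiv:2107.00446 — 2 statements merged into one kernel-verified Lean document; each statement's English description precedes it below -/
import Mathlib

section
/- Let G be an SLP over a weighted alphabet Σ, and let H_L and H_R be contracting SLPs (over the weighted alphabet V ∪ Σ, where each variable A of G is treated as a terminal symbol of weight ‖A‖) that define all prefixes of all left labeled heavy trees of G and all prefixes of all right labeled heavy trees of G, respectively. Let g be the total number of variables in G, H_L and H_R together and let r be the maximal length of a right-hand side occurring in them. Then there exists a contracting SLP G' over Σ that defines every string defined by G, has O(g) variables, and has right-hand sides of length O(r). -/
/-- A straight-line program: every variable has exactly one rule `rhs A`,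
and a ranking witnesses acyclicity (variables on right-hand sides have
smaller rank), so every variable derives a unique string `val A`. -/
structure SLP (V : Type) (Γ : Type) where
  rhs : V → List (V ⊕ Γ)
  rank : V → ℕ
  rank_lt : ∀ A B, Sum.inl B ∈ rhs A → rank B < rank A
  start : V

namespace SLP

variable {V Γ : Type}

/-- The string derived by a variable. -/
def val (G : SLP V Γ) (A : V) : List Γ :=
  ((G.rhs A).attach.map (fun β =>
    match β with
    | ⟨Sum.inl B, _⟩ => G.val B
    | ⟨Sum.inr a, _⟩ => [a])).flatten
termination_by G.rank A
decreasing_by exact G.rank_lt _ _ (by assumption)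

/-- A string is defined by the SLP if some variable derives it. -/
def defines (G : SLP V Γ) (s : List Γ) : Prop := ∃ A, G.val A = s

/-- The size of an SLP: total length of all right-hand sides. -/
def size [Fintype V] (G : SLP V Γ) : ℕ := ∑ A : V, (G.rhs A).length

end SLP

/-- Weight of a string over a weighted alphabet. -/
def wstr {Γ : Type} (w : Γ → ℕ) (s : List Γ) : ℕ := (s.map w).sum

namespace SLP

variable {V Γ : Type}

/-- Weight of the string derived by a variable. -/
def wval (G : SLP V Γ) (w : Γ → ℕ) (A : V) : ℕ := wstr w (G.val A)

/-- Weight of a symbol (variable or terminal). -/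
def symWeight (G : SLP V Γ) (w : Γ → ℕ) : V ⊕ Γ → ℕ
  | Sum.inl B => G.wval w B
  | Sum.inr a => w a

/-- An SLP is contracting (w.r.t. the weight `w`) if every variable `B` on the
right-hand side of a rule of `A` satisfies `‖B‖ ≤ ‖A‖/2`. -/
def Contracting (G : SLP V Γ) (w : Γ → ℕ) : Prop :=
  ∀ A B, Sum.inl B ∈ G.rhs A → 2 * G.wval w B ≤ G.wval w A

end SLP


/-- Weight of a string of symbols (variables or terminals). -/
def SLP.swstr {V Γ : Type} (G : SLP V Γ) (w : Γ → ℕ) (s : List (V ⊕ Γ)) : ℕ :=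
  (s.map (G.symWeight w)).sum

/-- `β` is a heavy child of `A`: `β` occurs on the right-hand side of the rule of
`A` and `‖β‖ > ‖rhs A‖ / 2`. -/
def SLP.HeavyChild {V Γ : Type} (G : SLP V Γ) (w : Γ → ℕ) (A : V) (β : V ⊕ Γ) : Prop :=
  β ∈ G.rhs A ∧ G.swstr w (G.rhs A) < 2 * G.symWeight w β

/-- A heavy symbol: a symbol that is the heavy child of some variable. -/
def SLP.HeavySym {V Γ : Type} (G : SLP V Γ) (w : Γ → ℕ) (β : V ⊕ Γ) : Prop :=
  ∃ A : V, G.HeavyChild w A β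

/-- Paths in the left labeled heavy trees of `G`. `G.HPathL w r α p` holds iff `r`
is the root of the heavy tree containing the symbol `α` (a symbol with no heavy
child) and `p` is the left labeling of the path from `r` to `α`: each edge of the
heavy forest goes from a variable `A` (with rule `A → u β v`, `β` the heavy child)
up to its parent `β`, and contributes the reversed light prefix `rev u`. -/
inductive SLP.HPathL {V Γ : Type} (G : SLP V Γ) (w : Γ → ℕ) :
    (V ⊕ Γ) → (V ⊕ Γ) → List (V ⊕ Γ) → Prop
  | root (β : V ⊕ Γ) :
      (∀ (B : V) (γ : V ⊕ Γ), β = Sum.inl B → ¬G.HeavyChild w B γ) →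
      SLP.HPathL G w β β []
  | step {r β : V ⊕ Γ} {p : List (V ⊕ Γ)} (A : V) (u v : List (V ⊕ Γ)) :
      SLP.HPathL G w r β p →
      G.rhs A = u ++ β :: v →
      G.swstr w (G.rhs A) < 2 * G.symWeight w β →
      SLP.HPathL G w r (Sum.inl A) (p ++ u.reverse)

/-- Paths in the right labeled heavy trees of `G`: as in `HPathL`, but each edge
contributes the light suffix `v`. -/
inductive SLP.HPathR {V Γ : Type} (G : SLP V Γ) (w : Γ → ℕ) :
    (V ⊕ Γ) → (V ⊕ Γ) → List (V ⊕ Γ) → Prop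
  | root (β : V ⊕ Γ) :
      (∀ (B : V) (γ : V ⊕ Γ), β = Sum.inl B → ¬G.HeavyChild w B γ) →
      SLP.HPathR G w β β []
  | step {r β : V ⊕ Γ} {p : List (V ⊕ Γ)} (A : V) (u v : List (V ⊕ Γ)) :
      SLP.HPathR G w r β p →
      G.rhs A = u ++ β :: v →
      G.swstr w (G.rhs A) < 2 * G.symWeight w β →
      SLP.HPathR G w r (Sum.inl A) (p ++ v)

/-- Replace every variable `B` of `s` by the string `t B`. -/
def expand {V Γ : Type} (t : V → List Γ) (s : List (V ⊕ Γ)) : List Γ :=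
  s.flatMap (Sum.elim t (fun a => [a]))

section expand

variable {V Γ : Type}

theorem expand_append (t : V → List Γ) (s s' : List (V ⊕ Γ)) :
    expand t (s ++ s') = expand t s ++ expand t s' := by
  simp [expand]

theorem wstr_append (w : Γ → ℕ) (s s' : List Γ) : wstr w (s ++ s') = wstr w s + wstr w s' := by
  simp [wstr]

theorem le_wstr_of_mem {w : Γ → ℕ} {s : List Γ} {a : Γ} (h : a ∈ s) : w a ≤ wstr w s :=
  List.single_le_sum (by simp) _ (List.mem_map_of_mem h)

theorem wstr_expand (w : Γ → ℕ) (t : V → List Γ) (s : List (V ⊕ Γ)) :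
    wstr w (expand t s) = wstr (fun x => wstr w (Sum.elim t (fun a => [a]) x)) s := by
  induction s with
  | nil => rfl
  | cons x s ih =>
    rw [← List.singleton_append, expand_append, wstr_append, wstr_append, ih]
    simp [expand, wstr]

theorem wstr_reverse (w : Γ → ℕ) (s : List Γ) : wstr w s.reverse = wstr w s := by
  simp [wstr, List.sum_reverse]

theorem eq_nil_of_wstr_eq_zero {w : Γ → ℕ} (hw : ∀ a, 0 < w a) {s : List Γ}
    (h : wstr w s = 0) : s = [] := by
  rcases s with _ | ⟨a, s⟩
  · rfl
  · have := hw a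
    simp [wstr] at h
    omega

theorem SLP.val_eq_expand (G : SLP V Γ) (A : V) : G.val A = expand G.val (G.rhs A) := by
  rw [SLP.val, expand, List.flatMap]
  congr 1
  conv_rhs => rw [← List.attach_map_subtype_val (G.rhs A), List.map_map]
  apply List.map_congr_left
  rintro ⟨x | x, hx⟩ _ <;> rfl

theorem SLP.wstr_elim_val (G : SLP V Γ) (w : Γ → ℕ) (x : V ⊕ Γ) :
    wstr w (Sum.elim G.val (fun a => [a]) x) = G.symWeight w x := by
  rcases x with B | a
  · rfl
  · simp [wstr, SLP.symWeight]

theorem SLP.wstr_expand_val (G : SLP V Γ) (w : Γ → ℕ) (s : List (V ⊕ Γ)) :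
    wstr w (expand G.val s) = wstr (G.symWeight w) s := by
  simp only [wstr_expand, G.wstr_elim_val]

theorem SLP.swstr_rhs (G : SLP V Γ) (w : Γ → ℕ) (A : V) :
    G.swstr w (G.rhs A) = G.wval w A := by
  rw [SLP.wval, G.val_eq_expand, G.wstr_expand_val]
  rfl

/-- A system of equations `t A = body A` whose variables at least halve in weight is realized by
a contracting SLP. Dropping the variables that derive the empty string makes the weight a
ranking. -/
theorem exists_contracting_slp (w : Γ → ℕ) (hw : ∀ a, 0 < w a) (start : V) (t : V → List Γ)
    (body : V → List (V ⊕ Γ)) (hbody : ∀ A, expand t (body A) = t A)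
    (hc : ∀ A B, Sum.inl B ∈ body A → 2 * wstr w (t B) ≤ wstr w (t A)) :
    ∃ G : SLP V Γ, (∀ A, (G.rhs A).length ≤ (body A).length) ∧ G.Contracting w ∧
      ∀ A, G.val A = t A := by
  classical
  let keep : V ⊕ Γ → Bool := Sum.elim (fun B => decide (0 < wstr w (t B))) (fun _ => true)
  have expand_filter : ∀ s, expand t (s.filter keep) = expand t s := by
    intro s
    induction s with
    | nil => rfl
    | cons x s ih =>
      rcases x with B | a
      · by_cases h : 0 < wstr w (t B)
        · simpa [keep, h, expand, List.filter_cons] using ih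
        · have h0 : t B = [] := eq_nil_of_wstr_eq_zero hw (by omega)
          simpa [keep, h0, expand, List.filter_cons, wstr] using ih
      · simpa [keep, expand, List.filter_cons] using ih
  have lt : ∀ A B, Sum.inl B ∈ (body A).filter keep → wstr w (t B) < wstr w (t A) := by
    intro A B h
    rw [List.mem_filter] at h
    have h1 := hc A B h.1
    have h2 : 0 < wstr w (t B) := by simpa [keep] using h.2
    omega
  let G : SLP V Γ := ⟨fun A => (body A).filter keep, fun A => wstr w (t A), lt, start⟩
  have val_eq : ∀ n A, wstr w (t A) = n → G.val A = t A := by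
    intro n
    induction n using Nat.strong_induction_on with
    | _ n ih =>
      rintro A rfl
      rw [G.val_eq_expand, ← hbody A, ← expand_filter]
      simp only [expand, List.flatMap]
      congr 1
      apply List.map_congr_left
      rintro (B | a) hx
      · exact ih _ (lt A B hx) B rfl
      · rfl
  have val_eq' : ∀ A, G.val A = t A := fun A => val_eq _ A rfl
  refine ⟨G, fun A => List.length_filter_le _ _, ?_, val_eq'⟩
  intro A B h
  simp only [SLP.wval, val_eq']
  exact hc A B (List.mem_filter.1 h).1

end expand

/-- Replacing each element by a list, of length greater than `1` only at elements heavier than half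
the total weight, adds the length of at most one such list. -/
theorem length_flatMap_le_of_heavy {α β : Type} (c : α → ℕ) (f : α → List β) (W M : ℕ)
    (hlight : ∀ x, 2 * c x ≤ W → (f x).length ≤ 1) (hM : ∀ x, (f x).length ≤ M + 1)
    (l : List α) (hl : wstr c l ≤ W) : (l.flatMap f).length ≤ l.length + M := by
  have light : ∀ l : List α, 2 * wstr c l ≤ W → (l.flatMap f).length ≤ l.length := by
    intro l
    induction l with
    | nil => simp
    | cons x l ih =>
      intro h
      have h' : 2 * (c x + wstr c l) ≤ W := by simpa [wstr] using h
      have h1 := ih (by omega)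
      have h2 := hlight x (by omega)
      simp only [List.flatMap_cons, List.length_append, List.length_cons]
      omega
  induction l with
  | nil => simp
  | cons x l ih =>
    have h' : c x + wstr c l ≤ W := by simpa [wstr] using hl
    simp only [List.flatMap_cons, List.length_append, List.length_cons]
    by_cases hx : 2 * c x ≤ W
    · have h1 := ih (by omega)
      have h2 := hlight x hx
      omega
    · have h1 := light l (by omega)
      have h2 := hM x
      omega

/-- The string of a variable `A` is composed of the light symbols along the heavy path of `A` and a
string `m` for the root of its heavy tree, all of which weigh at most half of `A`. -/
theorem SLP.exists_heavy_path {V Γ : Type} (G : SLP V Γ) (w : Γ → ℕ) (r : ℕ)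
    (hr : ∀ A, (G.rhs A).length ≤ r) (A : V) :
    ∃ (rt : V ⊕ Γ) (p q m : List (V ⊕ Γ)),
      G.HPathL w rt (Sum.inl A) p ∧ G.HPathR w rt (Sum.inl A) q ∧
      G.val A = expand G.val (p.reverse ++ m ++ q) ∧
      (∀ B, Sum.inl B ∈ p.reverse ++ m ++ q → 2 * G.wval w B ≤ G.wval w A) ∧
      m.length ≤ r := by
  induction hn : G.rank A using Nat.strong_induction_on generalizing A with
  | _ n ih =>
    subst hn
    by_cases hA : ∃ β, G.HeavyChild w A β
    · obtain ⟨β, hβ, hheavy⟩ := hA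
      have path : ∃ (rt : V ⊕ Γ) (p q m : List (V ⊕ Γ)),
          G.HPathL w rt β p ∧ G.HPathR w rt β q ∧
          Sum.elim G.val (fun a => [a]) β = expand G.val (p.reverse ++ m ++ q) ∧
          (∀ B, Sum.inl B ∈ p.reverse ++ m ++ q → 2 * G.wval w B ≤ G.symWeight w β) ∧
          m.length ≤ r := by
        rcases β with B | a
        · exact ih _ (G.rank_lt A B hβ) B rfl
        · refine ⟨Sum.inr a, [], [], [Sum.inr a], .root _ (by simp), .root _ (by simp),
            by simp [expand], by simp, ?_⟩
          exact (List.length_pos_of_mem hβ).trans_le (hr A)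
      obtain ⟨rt, p, q, m, hp, hq, hval, hlight, hm⟩ := path
      obtain ⟨u, v, huv⟩ := List.append_of_mem hβ
      have weight : G.wval w A =
          wstr (G.symWeight w) u + (G.symWeight w β + wstr (G.symWeight w) v) := by
        rw [← G.swstr_rhs, huv]
        simp [SLP.swstr, wstr]
      have heavy := hheavy
      rw [G.swstr_rhs] at heavy
      refine ⟨rt, p ++ u.reverse, q ++ v, m, .step A u v hp huv hheavy,
        .step A u v hq huv hheavy, ?_, ?_, hm⟩
      · rw [G.val_eq_expand, huv, ← List.singleton_append, expand_append, expand_append]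
        have : expand G.val [β] = expand G.val (p.reverse ++ m ++ q) := by
          rw [← hval]; simp [expand]
        rw [this]
        simp [expand_append]
      · intro B hB
        have cases : Sum.inl B ∈ u ∨ Sum.inl B ∈ v ∨ Sum.inl B ∈ p.reverse ++ m ++ q := by
          simp only [List.reverse_append, List.reverse_reverse, List.mem_append] at hB ⊢
          tauto
        rcases cases with h | h | h
        · have : G.wval w B ≤ wstr (G.symWeight w) u := le_wstr_of_mem (w := G.symWeight w) h
          omega
        · have : G.wval w B ≤ wstr (G.symWeight w) v := le_wstr_of_mem (w := G.symWeight w) h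
          omega
        · have := hlight B h
          omega
    · push Not at hA
      have root : ∀ (B : V) (γ : V ⊕ Γ),
          (Sum.inl A : V ⊕ Γ) = Sum.inl B → ¬G.HeavyChild w B γ := by
        rintro B γ h
        cases h
        exact hA γ
      refine ⟨Sum.inl A, [], [], G.rhs A, .root _ root, .root _ root, ?_, ?_, hr A⟩
      · simpa using G.val_eq_expand A
      · intro B hB
        have hB' : Sum.inl B ∈ G.rhs A := by simpa using hB
        have h := hA (Sum.inl B)
        by_contra hlt
        refine h ⟨hB', ?_⟩
        rw [G.swstr_rhs]
        exact not_le.1 hlt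

section substitution

variable {V VH Γ : Type}

/-- The strings over `Γ` derived by the variables of `G` and by those of an SLP over `V ⊕ Γ`. -/
def SLP.joinVal (G : SLP V Γ) (hval : VH → List (V ⊕ Γ)) : V ⊕ VH → List Γ :=
  Sum.elim G.val (fun Y => expand G.val (hval Y))

/-- View a symbol of an SLP over `V ⊕ Γ` as a symbol with variables `V ⊕ VH`. -/
def joinSym : VH ⊕ (V ⊕ Γ) → (V ⊕ VH) ⊕ Γ :=
  Sum.elim (fun Y => Sum.inl (Sum.inr Y)) (Sum.map Sum.inl id)

theorem expand_joinVal_map_inl (G : SLP V Γ) (hval : VH → List (V ⊕ Γ)) (s : List (V ⊕ Γ)) :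
    expand (G.joinVal hval) (s.map (Sum.map Sum.inl id)) = expand G.val s := by
  simp only [expand, List.flatMap_map]
  congr 1
  funext x
  rcases x with B | a <;> rfl

theorem elim_joinSym (G : SLP V Γ) (hval : VH → List (V ⊕ Γ)) (x : VH ⊕ (V ⊕ Γ)) :
    Sum.elim (G.joinVal hval) (fun a => [a]) (joinSym x) =
      expand G.val (Sum.elim hval (fun a => [a]) x) := by
  rcases x with Y | B | a <;> simp [joinSym, SLP.joinVal, expand]

theorem expand_joinVal_map_joinSym (G : SLP V Γ) (hval : VH → List (V ⊕ Γ))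
    (s : List (VH ⊕ (V ⊕ Γ))) :
    expand (G.joinVal hval) (s.map joinSym) = expand G.val (expand hval s) := by
  unfold expand
  rw [List.flatMap_map, List.flatMap_assoc]
  congr 1
  funext x
  exact elim_joinSym G hval x

/-- The new right-hand side for a variable of `G`. -/
theorem SLP.exists_body_of_variable (G : SLP V Γ) (w : Γ → ℕ) (r : ℕ)
    (hr : ∀ A, (G.rhs A).length ≤ r)
    (hval : VH → List (V ⊕ Γ)) (hrhs : VH → List (VH ⊕ (V ⊕ Γ)))
    (hexp : ∀ Y, expand hval (hrhs Y) = hval Y)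
    (hcontr : ∀ Y Z, Sum.inl Z ∈ hrhs Y →
      2 * wstr w (expand G.val (hval Z)) ≤ wstr w (expand G.val (hval Y)))
    (hlen : ∀ Y, (hrhs Y).length ≤ r)
    (hL : ∀ rt α p, G.HPathL w rt α p → ∃ Y, hval Y = p.reverse)
    (hR : ∀ rt α p, G.HPathR w rt α p → ∃ Y, hval Y = p) (A : V) :
    ∃ b : List ((V ⊕ VH) ⊕ Γ), b.length ≤ 3 * r ∧ expand (G.joinVal hval) b = G.val A ∧
      ∀ B, Sum.inl B ∈ b → 2 * wstr w (G.joinVal hval B) ≤ G.wval w A := by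
  obtain ⟨rt, p, q, m, hp, hq, hA, hlight, hm⟩ := G.exists_heavy_path w r hr A
  obtain ⟨X, hX⟩ := hL _ _ _ hp
  obtain ⟨Y, hY⟩ := hR _ _ _ hq
  have weight : G.wval w A = wstr w (expand G.val (hval X)) + wstr w (expand G.val m)
      + wstr w (expand G.val (hval Y)) := by
    rw [SLP.wval, hA, hX, hY]
    simp only [expand_append, wstr_append]
  have light_of_mem : ∀ Z, wstr w (expand G.val (hval Z)) ≤ G.wval w A →
      (∀ B, Sum.inl B ∈ hval Z → 2 * G.wval w B ≤ G.wval w A) →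
      ∀ B, Sum.inl B ∈ (hrhs Z).map joinSym →
        2 * wstr w (G.joinVal hval B) ≤ G.wval w A := by
    intro Z hZ hlZ B hB
    obtain ⟨x, hx, hxB⟩ := List.mem_map.1 hB
    rcases x with Z' | C | a
    · obtain rfl : Sum.inr Z' = B := Sum.inl.inj hxB
      exact (hcontr Z Z' hx).trans hZ
    · obtain rfl : Sum.inl C = B := Sum.inl.inj hxB
      refine hlZ C ?_
      rw [← hexp Z]
      exact List.mem_flatMap.2 ⟨_, hx, by simp⟩
    · exact absurd hxB (by simp [joinSym])
  refine ⟨(hrhs X).map joinSym ++ m.map (Sum.map Sum.inl id) ++ (hrhs Y).map joinSym,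
    ?_, ?_, ?_⟩
  · have h1 := hlen X
    have h2 := hlen Y
    simp only [List.length_append, List.length_map]
    omega
  · rw [hA]
    simp only [expand_append, expand_joinVal_map_joinSym, expand_joinVal_map_inl, hexp, hX, hY]
  · intro B hB
    simp only [List.mem_append] at hlight
    rcases List.mem_append.1 hB with hB | hB
    · rcases List.mem_append.1 hB with hB | hB
      · exact light_of_mem X (by omega) (fun C hC => hlight C (by rw [hX] at hC; tauto)) B hB
      · obtain ⟨x, hx, hxB⟩ := List.mem_map.1 hB
        rcases x with C | a
        · obtain rfl : Sum.inl C = B := Sum.inl.inj hxB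
          exact hlight C (by tauto)
        · exact absurd hxB (by simp)
    · exact light_of_mem Y (by omega) (fun C hC => hlight C (by rw [hY] at hC; tauto)) B hB

/-- The new right-hand side for a variable of an SLP over `V ⊕ Γ`: a heavy terminal `B` is replaced
by the new right-hand side of `B`. -/
theorem SLP.exists_body_of_label_variable (G : SLP V Γ) (w : Γ → ℕ) (r : ℕ)
    (hval : VH → List (V ⊕ Γ)) (hrhs : VH → List (VH ⊕ (V ⊕ Γ)))
    (hexp : ∀ Y, expand hval (hrhs Y) = hval Y)
    (hcontr : ∀ Y Z, Sum.inl Z ∈ hrhs Y →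
      2 * wstr w (expand G.val (hval Z)) ≤ wstr w (expand G.val (hval Y)))
    (hlen : ∀ Y, (hrhs Y).length ≤ r)
    (b : V → List ((V ⊕ VH) ⊕ Γ)) (hblen : ∀ A, (b A).length ≤ 3 * r)
    (hbexp : ∀ A, expand (G.joinVal hval) (b A) = G.val A)
    (hbcontr : ∀ A B, Sum.inl B ∈ b A → 2 * wstr w (G.joinVal hval B) ≤ G.wval w A) (Y : VH) :
    ∃ d : List ((V ⊕ VH) ⊕ Γ), d.length ≤ 4 * r ∧
      expand (G.joinVal hval) d = expand G.val (hval Y) ∧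
      ∀ B, Sum.inl B ∈ d →
        2 * wstr w (G.joinVal hval B) ≤ wstr w (expand G.val (hval Y)) := by
  classical
  set W := wstr w (expand G.val (hval Y)) with hW
  let f : VH ⊕ (V ⊕ Γ) → List ((V ⊕ VH) ⊕ Γ)
    | Sum.inr (Sum.inl B) => if 2 * G.wval w B ≤ W then [joinSym (Sum.inr (Sum.inl B))] else b B
    | x => [joinSym x]
  have f_expand : ∀ x, expand (G.joinVal hval) (f x) =
      expand G.val (Sum.elim hval (fun a => [a]) x) := by
    have single : ∀ x, expand (G.joinVal hval) [joinSym x] =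
        expand G.val (Sum.elim hval (fun a => [a]) x) := by
      intro x
      rw [← elim_joinSym]
      simp [expand]
    rintro (Z | B | a)
    · exact single _
    · by_cases h : 2 * G.wval w B ≤ W
      · simpa only [f, if_pos h] using single _
      · simp only [f, if_neg h, hbexp]
        simp [expand]
    · exact single _
  refine ⟨(hrhs Y).flatMap f, ?_, ?_, ?_⟩
  · have h := length_flatMap_le_of_heavy
      (fun x => wstr w (expand G.val (Sum.elim hval (fun a => [a]) x))) f W (3 * r) ?_ ?_
      (hrhs Y) ?_
    · have := hlen Y
      omega
    · rintro (Z | B | a) h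
      · simp [f]
      · have h' : 2 * G.wval w B ≤ W := by simpa [expand, SLP.wval] using h
        simp [f, h']
      · simp [f]
    · rintro (Z | B | a)
      · simp [f]
      · by_cases h : 2 * G.wval w B ≤ W
        · simp [f, h]
        · have := hblen B
          simp only [f, if_neg h]
          omega
      · simp [f]
    · rw [hW, ← hexp Y, G.wstr_expand_val, wstr_expand]
      simp only [G.wstr_expand_val, le_refl]
  · rw [← hexp Y]
    have := f_expand
    unfold expand at this ⊢
    rw [List.flatMap_assoc, List.flatMap_assoc]
    congr 1
    funext x
    exact this x
  · intro B hB
    obtain ⟨x, hx, hxB⟩ := List.mem_flatMap.1 hB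
    rcases x with Z | C | a
    · obtain rfl : B = Sum.inr Z := by simpa [f, joinSym] using hxB
      exact hcontr Y Z hx
    · by_cases h : 2 * G.wval w C ≤ W
      · obtain rfl : B = Sum.inl C := by simpa [f, h, joinSym] using hxB
        exact h
      · simp only [f, if_neg h] at hxB
        have := hbcontr C B hxB
        have hC : G.wval w C ≤ W := by
          rw [hW, G.wstr_expand_val]
          refine le_wstr_of_mem (w := G.symWeight w) (a := Sum.inl C) ?_
          rw [← hexp Y]
          exact List.mem_flatMap.2 ⟨_, hx, by simp⟩
        omega
    · exact absurd hxB (by simp [f, joinSym])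

end substitution

/-- Let `G` be an SLP over a weighted alphabet `Γ`, and let
`HL` and `HR` be contracting SLPs over the weighted alphabet `V ⊕ Γ` (each variable
`A` of `G` being a terminal of weight `‖A‖`) defining all prefixes of all left
labeled and of all right labeled heavy trees of `G`, respectively. Let `g` be the
total number of variables of `G`, `HL`, `HR` and `r` the maximal length of a
right-hand side occurring in them. Then there is a contracting SLP `G'` over `Γ`
defining every string defined by `G`, with `O(g)` variables and right-hand sides of
length `O(r)`. -/
theorem reduction_to_heavy_trees :
    ∃ c : ℕ,
      ∀ (V Γ VL VR : Type)
        (instV : Fintype V) (instΓ : Fintype Γ)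
        (instVL : Fintype VL) (instVR : Fintype VR)
        (w : Γ → ℕ), (∀ a : Γ, 0 < w a) →
        ∀ (G : SLP V Γ) (HL : SLP VL (V ⊕ Γ)) (HR : SLP VR (V ⊕ Γ)) (r : ℕ),
          HL.Contracting (G.symWeight w) →
          HR.Contracting (G.symWeight w) →
          (∀ (rt α : V ⊕ Γ) (p : List (V ⊕ Γ)), G.HPathL w rt α p → HL.defines p) →
          (∀ (rt α : V ⊕ Γ) (p : List (V ⊕ Γ)), G.HPathR w rt α p → HR.defines p) →
          (∀ A : V, (G.rhs A).length ≤ r) →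
          (∀ A : VL, (HL.rhs A).length ≤ r) →
          (∀ A : VR, (HR.rhs A).length ≤ r) →
          ∃ (V' : Type) (instV' : Fintype V') (G' : SLP V' Γ),
            Fintype.card V' ≤
              c * (Fintype.card V + Fintype.card VL + Fintype.card VR) ∧
            (∀ A : V', (G'.rhs A).length ≤ c * r) ∧
            G'.Contracting w ∧
            (∀ s : List Γ, G.defines s → G'.defines s) := by
  refine ⟨4, ?_⟩
  intro V Γ VL VR instV instΓ instVL instVR w hw G HL HR r hLc hRc hLd hRd hGr hLr hRr
  let hval : VL ⊕ VR → List (V ⊕ Γ) := Sum.elim (fun Y => (HL.val Y).reverse) HR.val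
  let hrhs : VL ⊕ VR → List ((VL ⊕ VR) ⊕ (V ⊕ Γ)) :=
    Sum.elim (fun Y => (HL.rhs Y).reverse.map (Sum.map Sum.inl id))
      (fun Z => (HR.rhs Z).map (Sum.map Sum.inr id))
  have hexp : ∀ Y, expand hval (hrhs Y) = hval Y := by
    rintro (Y | Z)
    · simp only [hval, hrhs, Sum.elim_inl]
      rw [HL.val_eq_expand]
      simp only [expand, List.flatMap_map, List.reverse_flatMap]
      congr 1
      funext x
      rcases x with B | a <;> simp
    · simp only [hval, hrhs, Sum.elim_inr]
      rw [HR.val_eq_expand]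
      simp only [expand, List.flatMap_map]
      congr 1
      funext x
      rcases x with B | a <;> simp
  have hcontr : ∀ Y Z, Sum.inl Z ∈ hrhs Y →
      2 * wstr w (expand G.val (hval Z)) ≤ wstr w (expand G.val (hval Y)) := by
    intro Y Z h
    simp only [G.wstr_expand_val]
    rcases Y with Y | Y
    · obtain ⟨x, hx, hxZ⟩ := List.mem_map.1 h
      rcases x with Z' | a
      · obtain rfl : Sum.inl Z' = Z := Sum.inl.inj hxZ
        simp only [hval, Sum.elim_inl, wstr_reverse]
        exact hLc Y Z' (List.mem_reverse.1 hx)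
      · exact absurd hxZ (by simp)
    · obtain ⟨x, hx, hxZ⟩ := List.mem_map.1 h
      rcases x with Z' | a
      · obtain rfl : Sum.inr Z' = Z := Sum.inl.inj hxZ
        exact hRc Y Z' hx
      · exact absurd hxZ (by simp)
  have hlen : ∀ Y, (hrhs Y).length ≤ r := by
    rintro (Y | Y)
    · simpa [hrhs] using hLr Y
    · simpa [hrhs] using hRr Y
  have hL : ∀ rt α p, G.HPathL w rt α p → ∃ Y, hval Y = p.reverse := by
    intro rt α p h
    obtain ⟨Y, rfl⟩ := hLd rt α p h
    exact ⟨Sum.inl Y, rfl⟩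
  have hR : ∀ rt α p, G.HPathR w rt α p → ∃ Y, hval Y = p := by
    intro rt α p h
    obtain ⟨Y, rfl⟩ := hRd rt α p h
    exact ⟨Sum.inr Y, rfl⟩
  choose b hblen hbexp hbcontr using
    G.exists_body_of_variable w r hGr hval hrhs hexp hcontr hlen hL hR
  choose d hdlen hdexp hdcontr using
    G.exists_body_of_label_variable w r hval hrhs hexp hcontr hlen b hblen hbexp hbcontr
  obtain ⟨G', hG'len, hG'contr, hG'val⟩ := exists_contracting_slp w hw
    (Sum.inr (Sum.inl HL.start)) (G.joinVal hval) (Sum.elim b d)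
    (by rintro (A | Y); exacts [hbexp A, hdexp Y])
    (by rintro (A | Y) B h; exacts [hbcontr A B h, hdcontr Y B h])
  refine ⟨V ⊕ (VL ⊕ VR), inferInstance, G', ?_, ?_, hG'contr, ?_⟩
  · simp only [Fintype.card_sum]
    omega
  · rintro (A | Y)
    · have h1 := hG'len (Sum.inl A)
      have h2 := hblen A
      simp only [Sum.elim_inl] at h1
      omega
    · exact (hG'len (Sum.inr Y)).trans (hdlen Y)
  · rintro s ⟨A, rfl⟩
    exact ⟨Sum.inl A, hG'val _⟩
end

section
/- Let n ≥ 2 and let s = a₁…a_n be the weighted string over the weighted alphabet {a₁,…,a_n} where ‖a_i‖ = 2^{n−i}. Then every contracting SLP whose right-hand sides all have length at most 2 and which defines all nonempty prefixes of s has at least n(n−1)/2 variables. -/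
namespace SLP

variable {V Γ : Type}

/-- The string derived by a symbol. -/
def symVal (G : SLP V Γ) : V ⊕ Γ → List Γ
  | Sum.inl B => G.val B
  | Sum.inr a => [a]

theorem val_eq_flatten_map_symVal (G : SLP V Γ) (A : V) :
    G.val A = ((G.rhs A).map G.symVal).flatten := by
  rw [val]
  congr 1
  conv_rhs => rw [← List.attach_map_subtype_val (G.rhs A), List.map_map]
  refine List.map_congr_left fun x _ => ?_
  rcases x with ⟨B | a, h⟩ <;> rfl

/-- In a contracting SLP with right-hand sides of length at most two, a variable deriving a string
whose first letter outweighs the rest has a rule splitting off that letter. -/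
theorem Contracting.defines_tail {G : SLP V Γ} {w : Γ → ℕ} (hG : G.Contracting w) {A : V}
    (hlen : (G.rhs A).length ≤ 2) {a : Γ} {t : List Γ} (hA : G.val A = a :: t)
    (ht : 2 ≤ t.length) (hw : wstr w t < w a) : G.defines t := by
  have hval := G.val_eq_flatten_map_symVal A
  have heavy : ∀ B u, Sum.inl B ∈ G.rhs A → G.val B ≠ a :: u := by
    intro B u hB hu
    have h := hG A B hB
    simp only [wval, hA, hu, wstr, List.map_cons, List.sum_cons] at h hw
    omega
  rw [hA] at hval
  rcases hr : G.rhs A with _ | ⟨x, _ | ⟨y, _ | ⟨z, l⟩⟩⟩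
  · simp [hr] at hval
  · rcases x with B | b
    · simp only [hr, symVal, List.map_cons, List.map_nil, List.flatten_cons, List.flatten_nil,
        List.append_nil] at hval
      exact absurd hval.symm (heavy B t (by simp [hr]))
    · simp only [hr, symVal, List.map_cons, List.map_nil, List.flatten_cons, List.flatten_nil,
        List.append_nil, List.cons.injEq] at hval
      simp [hval.2] at ht
  · simp only [hr, List.map_cons, List.map_nil, List.flatten_cons, List.flatten_nil,
      List.append_nil] at hval
    have tail_of_second : ∀ u, G.symVal y = u → 2 ≤ u.length → G.defines u := by
      intro u hu hu2
      rcases y with C | c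
      · exact ⟨C, hu⟩
      · simp [symVal, ← hu] at hu2
    rcases x with B | b
    · rcases hB : G.val B with _ | ⟨c, u⟩
      · simp only [symVal, hB, List.nil_append] at hval
        rcases y with C | c
        · exact absurd hval.symm (heavy C t (by simp [hr]))
        · simp only [List.cons.injEq] at hval
          simp [hval.2] at ht
      · simp only [symVal, hB, List.cons_append, List.cons.injEq] at hval
        exact absurd (hval.1 ▸ hB) (heavy B u (by simp [hr]))
    · simp only [symVal, List.cons_append, List.nil_append, List.cons.injEq] at hval
      exact tail_of_second t hval.2.symm ht
  · simp [hr] at hlen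

end SLP

/-- With geometrically decreasing weights, a letter outweighs every increasing string of
later letters. -/
theorem wstr_two_pow_lt {n : ℕ} {l : List (Fin n)} {i : Fin n} (hl : (i :: l).Pairwise (· < ·)) :
    wstr (fun i : Fin n => 2 ^ (n - 1 - (i : ℕ))) l < 2 ^ (n - 1 - (i : ℕ)) := by
  induction l generalizing i with
  | nil => simp [wstr]
  | cons b t ih =>
    obtain ⟨hi, ht⟩ := List.pairwise_cons.1 hl
    have hb := ih ht
    have hib : (i : ℕ) < b := hi b (by simp)
    have hbn := b.isLt
    have hpow : 2 * 2 ^ (n - 1 - (b : ℕ)) ≤ 2 ^ (n - 1 - (i : ℕ)) := by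
      rw [← pow_succ']
      exact Nat.pow_le_pow_right (by norm_num) (by omega)
    simp only [wstr, List.map_cons, List.sum_cons] at hb ⊢
    omega

/-- Let `n ≥ 2` and let `s = a₁…a_n` be the weighted string over
the weighted alphabet `{a₁,…,a_n}` (modelled as `Fin n`) where `‖a_i‖ = 2^(n−i)`.
Every contracting SLP whose right-hand sides all have length at most `2` and which
defines all nonempty prefixes of `s` has at least `n(n−1)/2` variables. -/
theorem short_rhs_contracting_lower_bound :
    ∀ n : ℕ, 2 ≤ n →
      ∀ (V : Type) (instV : Fintype V) (G : SLP V (Fin n)),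
        (∀ A : V, (G.rhs A).length ≤ 2) →
        G.Contracting (fun i : Fin n => 2 ^ (n - 1 - (i : ℕ))) →
        (∀ k : ℕ, 1 ≤ k → k ≤ n → G.defines ((List.finRange n).take k)) →
        n * (n - 1) / 2 ≤ Fintype.card V := by
  intro n _ V _ G hlen hG hdef
  have hsub : ∀ i j : ℕ, i + 2 ≤ j → j ≤ n → G.defines (((List.finRange n).take j).drop i) := by
    intro i j
    induction i with
    | zero => exact fun h hj => by simpa using hdef j (by omega) hj
    | succ i ih =>
      intro h hj
      obtain ⟨A, hA⟩ := ih (by omega) hj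
      have hcons := List.drop_eq_getElem_cons (l := (List.finRange n).take j) (i := i)
        (by simp; omega)
      have hsorted : (((List.finRange n).take j).drop i).Pairwise (· < ·) :=
        ((List.sortedLT_finRange n).pairwise.sublist (List.take_sublist _ _)).sublist
          (List.drop_sublist _ _)
      rw [hcons] at hA hsorted
      exact hG.defines_tail (hlen A) hA (by simp; omega) (wstr_two_pow_lt hsorted)
  choose f hf using fun p : Σ j : Fin n, Fin (j : ℕ) =>
    hsub p.2 (p.1 + 1) (by have := p.2.isLt; omega) p.1.isLt
  have hinj : Function.Injective f := by
    rintro ⟨j, i⟩ ⟨j', i'⟩ h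
    have heq := (hf ⟨j, i⟩).symm.trans ((congrArg G.val h).trans (hf ⟨j', i'⟩))
    have hi := i.isLt
    have hi' := i'.isLt
    have hj := j.isLt
    have hj' := j'.isLt
    have hlength := congrArg List.length heq
    have hhead := congrArg (fun l => l[0]?.map Fin.val) heq
    simp only [List.length_drop, List.length_take, List.length_finRange] at hlength
    rw [List.getElem?_eq_getElem (by simp), List.getElem?_eq_getElem (by simp)]
      at hhead
    simp at hhead
    obtain rfl : j = j' := Fin.ext (by omega)
    obtain rfl : i = i' := Fin.ext hhead
    rfl
  have hcard := Fintype.card_le_of_injective f hinj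
  simpa [Fin.sum_univ_eq_sum_range (fun j => j), Finset.sum_range_id] using hcard
end
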